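/- 2Reg(G) is a 3-hypercycle if and only if G (after removing isolated vertices) is either the claw graph K_{1,3} or the triangle graph C_3. -/

import Mathlib

def twoRegVerts {V : Type*} [DecidableEq V] (E : Finset (Finset V)) :
    Finset (Finset (Finset V)) :=
  E.powerset.filter (fun w => w.card = 2 ∧ ∃ e ∈ w, ∃ e' ∈ w, e ≠ e' ∧ (e ∩ e').Nonempty)

def hyperedge {V : Type*} [DecidableEq V] (E : Finset (Finset V)) (e : Finset V) :
    Finset (Finset (Finset V)) :=
  (twoRegVerts E).filter (fun w => e ∈ w)

/-- 2Reg(G) (for the edge set `E`) is a `k`-hypercycle. -/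
def IsKHypercycle {V : Type*} [DecidableEq V] (k : ℕ) [NeZero k]
    (E : Finset (Finset V)) : Prop :=
  ∃ (e : ZMod k → Finset V) (w : ZMod k → Finset (Finset V)),
    Function.Injective e ∧ E = Finset.univ.image e ∧
    Function.Injective w ∧ twoRegVerts E = Finset.univ.image w ∧
    ∀ i, hyperedge E (e i) = {w i, w (i + 1)}

/-- `E` is the edge set of a claw `K_{1,3}`. -/
def IsClaw {V : Type*} [DecidableEq V] (E : Finset (Finset V)) : Prop :=
  ∃ c a b d : V, a ≠ b ∧ a ≠ d ∧ b ≠ d ∧ c ≠ a ∧ c ≠ b ∧ c ≠ d ∧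
    E = {{c, a}, {c, b}, {c, d}}

/-- `E` is the edge set of a triangle `C_3`. -/
def IsTriangle {V : Type*} [DecidableEq V] (E : Finset (Finset V)) : Prop :=
  ∃ a b c : V, a ≠ b ∧ b ≠ c ∧ a ≠ c ∧ E = {{a, b}, {b, c}, {a, c}}

theorem mem_twoRegVerts' {V : Type*} [DecidableEq V] (E : Finset (Finset V))
    (w : Finset (Finset V)) :
    w ∈ twoRegVerts E ↔ ∃ a ∈ E, ∃ b ∈ E, a ≠ b ∧ (a ∩ b).Nonempty ∧ w = {a, b} := by
  unfold twoRegVerts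
  rw [Finset.mem_filter, Finset.mem_powerset]
  constructor
  · rintro ⟨hw, hc, a, ha, b, hb, hab, hne⟩
    refine ⟨a, hw ha, b, hw hb, hab, hne, ?_⟩
    symm
    apply Finset.eq_of_subset_of_card_le
    · intro t ht
      simp only [Finset.mem_insert, Finset.mem_singleton] at ht
      rcases ht with rfl | rfl <;> assumption
    · rw [hc, Finset.card_pair hab]
  · rintro ⟨a, ha, b, hb, hab, hne, rfl⟩
    refine ⟨?_, Finset.card_pair hab, a, by simp, b, by simp, hab, hne⟩
    intro t ht
    simp only [Finset.mem_insert, Finset.mem_singleton] at ht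
    rcases ht with rfl | rfl <;> assumption

theorem twoRegVerts_subset {V : Type*} [DecidableEq V] (x y z : Finset V) :
    twoRegVerts {x, y, z} ⊆ {{z, x}, {x, y}, {y, z}} := by
  intro w hw
  rw [mem_twoRegVerts'] at hw
  obtain ⟨a, ha, b, hb, hab, -, rfl⟩ := hw
  simp only [Finset.mem_insert, Finset.mem_singleton] at ha hb ⊢
  rcases ha with rfl | rfl | rfl <;> rcases hb with rfl | rfl | rfl <;>
    simp_all [Finset.pair_comm]

theorem pair_mem_inter {V : Type*} [DecidableEq V] {E : Finset (Finset V)} {x y : Finset V}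
    (h : {x, y} ∈ twoRegVerts E) : (x ∩ y).Nonempty := by
  rw [mem_twoRegVerts'] at h
  obtain ⟨a, -, b, -, hab, hne, h⟩ := h
  have ha : a ∈ ({x, y} : Finset (Finset V)) := by rw [h]; simp
  have hb : b ∈ ({x, y} : Finset (Finset V)) := by rw [h]; simp
  simp only [Finset.mem_insert, Finset.mem_singleton] at ha hb
  rcases ha with rfl | rfl <;> rcases hb with rfl | rfl
  · exact absurd rfl hab
  · exact hne
  · rwa [Finset.inter_comm]
  · exact absurd rfl hab

theorem univ_image_three {α : Type*} [DecidableEq α] (f : ZMod 3 → α) :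
    Finset.univ.image f = {f 0, f 1, f 2} := by
  have : (Finset.univ : Finset (ZMod 3)) = {0, 1, 2} := by decide
  rw [this]; simp

theorem forall_three {p : ZMod 3 → Prop} (h0 : p 0) (h1 : p 1) (h2 : p 2) : ∀ i, p i := by
  intro i
  have : i = 0 ∨ i = 1 ∨ i = 2 := by revert i; decide
  rcases this with rfl | rfl | rfl <;> assumption

theorem inj_three {α : Type*} (f : ZMod 3 → α) (h01 : f 0 ≠ f 1) (h02 : f 0 ≠ f 2)
    (h12 : f 1 ≠ f 2) : Function.Injective f := by
  intro i
  revert i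
  refine forall_three ?_ ?_ ?_ <;> refine forall_three ?_ ?_ ?_ <;> intro h <;>
    first | rfl | exact absurd h (by assumption) | exact absurd h.symm (by assumption)

theorem hyper_of_inter {V : Type*} [DecidableEq V] (x y z : Finset V)
    (hxy : x ≠ y) (hxz : x ≠ z) (hyz : y ≠ z)
    (ixy : (x ∩ y).Nonempty) (ixz : (x ∩ z).Nonempty) (iyz : (y ∩ z).Nonempty) :
    IsKHypercycle 3 ({x, y, z} : Finset (Finset V)) := by
  have hT : twoRegVerts {x, y, z} = {{z, x}, {x, y}, {y, z}} := by
    apply Finset.Subset.antisymm (twoRegVerts_subset x y z)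
    intro w hw
    rw [mem_twoRegVerts']
    simp only [Finset.mem_insert, Finset.mem_singleton] at hw
    rcases hw with rfl | rfl | rfl
    · exact ⟨z, by simp, x, by simp, hxz.symm, by rwa [Finset.inter_comm], rfl⟩
    · exact ⟨x, by simp, y, by simp, hxy, ixy, rfl⟩
    · exact ⟨y, by simp, z, by simp, hyz, iyz, rfl⟩
  have n1 : ({z, x} : Finset (Finset V)) ≠ {x, y} := by
    intro h
    have : z ∈ ({x, y} : Finset (Finset V)) := by rw [← h]; simp
    simp [hxz.symm, hyz.symm] at this
  have n2 : ({z, x} : Finset (Finset V)) ≠ {y, z} := by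
    intro h
    have : x ∈ ({y, z} : Finset (Finset V)) := by rw [← h]; simp
    simp [hxz, hxy] at this
  have n3 : ({x, y} : Finset (Finset V)) ≠ {y, z} := by
    intro h
    have : x ∈ ({y, z} : Finset (Finset V)) := by rw [← h]; simp
    simp [hxz, hxy] at this
  let e : ZMod 3 → Finset V := (![x, y, z] : Fin 3 → Finset V)
  let w : ZMod 3 → Finset (Finset V) :=
    (![{z, x}, {x, y}, {y, z}] : Fin 3 → Finset (Finset V))
  have e0 : e 0 = x := rfl
  have e1 : e 1 = y := rfl
  have e2 : e 2 = z := rfl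
  have w0 : w 0 = {z, x} := rfl
  have w1 : w 1 = {x, y} := rfl
  have w2 : w 2 = {y, z} := rfl
  have s1 : (0 : ZMod 3) + 1 = 1 := by decide
  have s2 : (1 : ZMod 3) + 1 = 2 := by decide
  have s3 : (2 : ZMod 3) + 1 = 0 := by decide
  refine ⟨e, w, inj_three e ?_ ?_ ?_, ?_, inj_three w ?_ ?_ ?_, ?_, forall_three ?_ ?_ ?_⟩
  · rwa [e0, e1]
  · rwa [e0, e2]
  · rwa [e1, e2]
  · rw [univ_image_three, e0, e1, e2]
  · rwa [w0, w1]
  · rwa [w0, w2]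
  · rwa [w1, w2]
  · rw [univ_image_three, w0, w1, w2, hT]
  · rw [s1, e0, w0, w1, hyperedge, hT]
    simp [Finset.filter_insert, Finset.filter_singleton, hxy, hxz]
  · rw [s2, e1, w1, w2, hyperedge, hT]
    simp [Finset.filter_insert, Finset.filter_singleton, hxy.symm, hyz]
  · rw [s3, e2, w2, w0, hyperedge, hT]
    simp [Finset.filter_insert, Finset.filter_singleton, hxz.symm, hyz.symm, Finset.pair_comm]

theorem pair_of_mem {V : Type*} [DecidableEq V] {x : Finset V} {c : V} (h : x.card = 2)
    (hc : c ∈ x) : ∃ a, c ≠ a ∧ x = {c, a} := by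
  obtain ⟨p, q, hpq, rfl⟩ := Finset.card_eq_two.1 h
  simp only [Finset.mem_insert, Finset.mem_singleton] at hc
  rcases hc with rfl | rfl
  · exact ⟨q, hpq, rfl⟩
  · exact ⟨p, hpq.symm, Finset.pair_comm _ _⟩

theorem pair_ne {V : Type*} [DecidableEq V] {a b c d : V} (h1 : a ≠ c) (h2 : a ≠ d) :
    ({a, b} : Finset V) ≠ {c, d} := by
  intro h
  have : a ∈ ({c, d} : Finset V) := by rw [← h]; simp
  simp [h1, h2] at this

theorem inter_ne {V : Type*} [DecidableEq V] {x y : Finset V} (c : V) (h1 : c ∈ x) (h2 : c ∈ y) :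
    (x ∩ y).Nonempty := ⟨c, Finset.mem_inter.2 ⟨h1, h2⟩⟩

theorem stmt6 {V : Type*} [DecidableEq V] (E : Finset (Finset V))
    (hE : ∀ e ∈ E, e.card = 2) :
    IsKHypercycle 3 E ↔ (IsClaw E ∨ IsTriangle E) := by
  constructor
  · rintro ⟨e, w, he, hEe, hw, hT, -⟩
    have hc : (twoRegVerts E).card = 3 := by
      rw [hT, Finset.card_image_of_injective _ hw]; rfl
    rw [univ_image_three] at hEe
    have hxy : e 0 ≠ e 1 := he.ne (by decide)
    have hxz : e 0 ≠ e 2 := he.ne (by decide)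
    have hyz : e 1 ≠ e 2 := he.ne (by decide)
    generalize e 0 = x at *
    generalize e 1 = y at *
    generalize e 2 = z at *
    clear hT
    subst hEe
    have hT := Finset.eq_of_subset_of_card_le (twoRegVerts_subset x y z)
      (by rw [hc]; exact Finset.card_le_three)
    have izx : (z ∩ x).Nonempty := pair_mem_inter (by rw [hT]; simp)
    have ixy : (x ∩ y).Nonempty := pair_mem_inter (by rw [hT]; simp)
    have iyz : (y ∩ z).Nonempty := pair_mem_inter (by rw [hT]; simp)
    have cx : x.card = 2 := hE x (by simp)
    have cy : y.card = 2 := hE y (by simp)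
    have cz : z.card = 2 := hE z (by simp)
    clear hT hc hE
    obtain ⟨c, hcc⟩ := ixy
    rw [Finset.mem_inter] at hcc
    obtain ⟨a, hca, rfl⟩ := pair_of_mem cx hcc.1
    obtain ⟨b, hcb, rfl⟩ := pair_of_mem cy hcc.2
    have hab : a ≠ b := by rintro rfl; exact hxy rfl
    by_cases hz : c ∈ z
    · obtain ⟨d, hcd, rfl⟩ := pair_of_mem cz hz
      left
      refine ⟨c, a, b, d, hab, ?_, ?_, hca, hcb, hcd, rfl⟩
      · rintro rfl; exact hxz rfl
      · rintro rfl; exact hyz rfl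
    · right
      obtain ⟨p, hp⟩ := izx
      obtain ⟨q, hq⟩ := iyz
      simp only [Finset.mem_inter, Finset.mem_insert, Finset.mem_singleton] at hp hq
      have ha : a ∈ z := by
        rcases hp with ⟨h, rfl | rfl⟩
        · exact absurd h hz
        · exact h
      have hb : b ∈ z := by
        rcases hq with ⟨rfl | rfl, h⟩
        · exact absurd h hz
        · exact h
      obtain ⟨d, had, rfl⟩ := pair_of_mem cz ha
      have : b = d := by
        simpa [hab.symm] using hb
      subst this
      exact ⟨a, c, b, hca.symm, hcb, hab, by rw [Finset.pair_comm a c]⟩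
  · rintro (⟨c, a, b, d, hab, had, hbd, hca, hcb, hcd, rfl⟩ | ⟨a, b, c, hab, hbc, hac, rfl⟩)
    · apply hyper_of_inter
      · rw [Finset.pair_comm c a]; exact pair_ne hca.symm hab
      · rw [Finset.pair_comm c a]; exact pair_ne hca.symm had
      · rw [Finset.pair_comm c b]; exact pair_ne hcb.symm hbd
      all_goals exact inter_ne c (by simp) (by simp)
    · apply hyper_of_inter
      · exact pair_ne hab hac
      · rw [Finset.pair_comm a b]; exact pair_ne hab.symm hbc
      · exact pair_ne hab.symm hbc
      · exact inter_ne b (by simp) (by simp)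
      · exact inter_ne a (by simp) (by simp)
      · exact inter_ne c (by simp) (by simp)
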